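/- Let n ≥ 3 and −1 < α < ∞. There is a constant c₃ depending only on n and α (and not on δ) such that for every 0 < δ < 1, the weight ω(x) = (1−|x|²)^s with s = (α+1)(1−δ) satisfies, for every ball B_ρ = B_ρ(x,r) with x ∈ ∂𝔹_n and 0 < r < 1, the inequality (∫_{B̂_ρ} ω dν_α)·(∫_{B̂_ρ} ω^{−1} dν_α) ≤ (c₃/δ)·ν_α(B̂_ρ)²; in particular the Bekollé–Bonami constant satisfies [ω]_{2,α} ≤ c₃/δ. -/

import Mathlib

open MeasureTheory Metric
open scoped ENNReal RealInnerProductSpace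

noncomputable section

abbrev Eucl (n : ℕ) : Type := EuclideanSpace ℝ (Fin n)

/-- The spherical (angular) distance `ρ(x,y) = arccos ⟨x,y⟩`. -/
def rho {n : ℕ} (x y : Eucl n) : ℝ := Real.arccos ⟪x, y⟫

/-- The (unnormalized) weighted measure `(1-|x|²)^α dν` on the unit ball. -/
def muA (n : ℕ) (α : ℝ) : Measure (Eucl n) :=
  (volume.restrict (ball (0 : Eucl n) 1)).withDensity
    fun x => ENNReal.ofReal ((1 - ‖x‖ ^ 2) ^ α)

/-- The normalized weighted measure `ν_α` with `ν_α(𝔹_n) = 1`. -/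
def nuA (n : ℕ) (α : ℝ) : Measure (Eucl n) := (muA n α Set.univ)⁻¹ • muA n α

/-- The spherical ball `B_ρ(x,r)` on the unit sphere. -/
def sBall {n : ℕ} (x : Eucl n) (r : ℝ) : Set (Eucl n) := {y | ‖y‖ = 1 ∧ rho x y < r}

/-- The Carleson box of the spherical ball `B_ρ(x,r)`. -/
def cBoxBall {n : ℕ} (x : Eucl n) (r : ℝ) : Set (Eucl n) :=
  {z | ‖z‖ < 1 ∧ 1 - r < ‖z‖ ∧ ‖z‖⁻¹ • z ∈ sBall x r}

/-- The `ρ`-diameter of a subset of the sphere. -/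
def diamRho {n : ℕ} (Q : Set (Eucl n)) : ℝ :=
  sSup {d | ∃ x ∈ Q, ∃ y ∈ Q, d = rho x y}

/-- The Carleson box of a subset `Q` of the sphere. -/
def cBox {n : ℕ} (Q : Set (Eucl n)) : Set (Eucl n) :=
  {z | ‖z‖ < 1 ∧ 1 - diamRho Q / 2 < ‖z‖ ∧ ‖z‖⁻¹ • z ∈ Q}

/-- The `ε`-Carleson box of a subset `Q` of the sphere. -/
def cBoxEps {n : ℕ} (ε : ℝ) (Q : Set (Eucl n)) : Set (Eucl n) :=
  {z | ‖z‖ < 1 ∧ 1 - ε * diamRho Q / 2 < ‖z‖ ∧ ‖z‖⁻¹ • z ∈ Q}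

/-- `|S|_{ω,α} = ∫_S ω dν_α`. -/
def wInt {n : ℕ} (α : ℝ) (ω : Eucl n → ℝ) (S : Set (Eucl n)) : ℝ≥0∞ :=
  ∫⁻ x in S, ENNReal.ofReal (ω x) ∂(nuA n α)

/-- The Bekollé–Bonami constant `[ω]_{p,α}` (with `p' = p/(p-1)`). -/
def BB (n : ℕ) (p α : ℝ) (ω : Eucl n → ℝ) : ℝ≥0∞ :=
  ⨆ (x : Eucl n) (_ : ‖x‖ = 1) (r : ℝ) (_ : 0 < r) (_ : r < 1),
    (wInt α ω (cBoxBall x r) / nuA n α (cBoxBall x r)) *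
      (wInt α (fun y => ω y ^ (1 - p / (p - 1))) (cBoxBall x r) /
        nuA n α (cBoxBall x r)) ^ (p - 1)

/-- The maximal operator `M_α` over Carleson boxes of spherical balls. -/
def maxOp (n : ℕ) (α : ℝ) (f : Eucl n → ℝ) (x : Eucl n) : ℝ≥0∞ :=
  ⨆ (ξ : Eucl n) (_ : ‖ξ‖ = 1) (r : ℝ) (_ : 0 < r) (_ : r < 1),
    (cBoxBall ξ r).indicator
      (fun _ => (∫⁻ y in cBoxBall ξ r, ENNReal.ofReal |f y| ∂(nuA n α)) /
        nuA n α (cBoxBall ξ r)) x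

/-- The `L^q(ω dν_α)` "norm" of an `ℝ≥0∞`-valued function. -/
def pnormW (n : ℕ) (α q : ℝ) (ω : Eucl n → ℝ) (F : Eucl n → ℝ≥0∞) : ℝ≥0∞ :=
  (∫⁻ x, F x ^ q * ENNReal.ofReal (ω x) ∂(nuA n α)) ^ (1 / q)

open Set

section Polar

variable {E : Type*} [NormedAddCommGroup E] [NormedSpace ℝ E] [MeasurableSpace E] [BorelSpace E]
  [FiniteDimensional ℝ E] [Nontrivial E]

/-- Integration in polar coordinates of a product of an angular and a radial function. -/
theorem lintegral_angular_mul_radial (μ : Measure E) [μ.IsAddHaarMeasure] {g : E → ℝ≥0∞}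
    {f : ℝ → ℝ≥0∞} (hg : Measurable g) (hf : Measurable f) :
    ∫⁻ z, g (‖z‖⁻¹ • z) * f ‖z‖ ∂μ =
      (∫⁻ u : sphere (0 : E) 1, g u ∂μ.toSphere) *
        ∫⁻ t in Ioi (0 : ℝ), ENNReal.ofReal (t ^ (Module.finrank ℝ E - 1)) * f t := by
  calc
    ∫⁻ z, g (‖z‖⁻¹ • z) * f ‖z‖ ∂μ
        = ∫⁻ z : ({(0)}ᶜ : Set E), g (‖z.1‖⁻¹ • z.1) * f ‖z.1‖ ∂(μ.comap (↑)) := by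
      rw [lintegral_subtype_comap (measurableSet_singleton _).compl
        fun z ↦ g (‖z‖⁻¹ • z) * f ‖z‖, restrict_compl_singleton]
    _ = ∫⁻ p : sphere (0 : E) 1 × Ioi (0 : ℝ), g p.1 * f p.2
          ∂μ.toSphere.prod (.volumeIoiPow (Module.finrank ℝ E - 1)) := by
      rw [← μ.measurePreserving_homeomorphUnitSphereProd.lintegral_comp_emb
        (Homeomorph.measurableEmbedding _)]
      simp
    _ = (∫⁻ u : sphere (0 : E) 1, g u ∂μ.toSphere) *
          ∫⁻ t : Ioi (0 : ℝ), f t ∂.volumeIoiPow (Module.finrank ℝ E - 1) :=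
      lintegral_prod_mul (hg.comp measurable_subtype_coe).aemeasurable
        (hf.comp measurable_subtype_coe).aemeasurable
    _ = _ := by
      rw [Measure.volumeIoiPow, lintegral_withDensity_eq_lintegral_mul _ (by fun_prop)
        (g := fun t : Ioi (0 : ℝ) ↦ f t) (hf.comp measurable_subtype_coe),
        ← lintegral_subtype_comap measurableSet_Ioi
          fun t : ℝ ↦ ENNReal.ofReal (t ^ (Module.finrank ℝ E - 1)) * f t]
      rfl

end Polar

/-- The radial factor of `∫ (1-|z|²)^γ` over a Carleson box of height `r`. -/
def radialIntegral (n : ℕ) (γ r : ℝ) : ℝ≥0∞ :=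
  ∫⁻ t in Ioo (1 - r) 1, ENNReal.ofReal (t ^ (n - 1) * (1 - t ^ 2) ^ γ)

theorem measurableSet_sBall {n : ℕ} (x : Eucl n) (r : ℝ) : MeasurableSet (sBall x r) := by
  have h : Measurable fun y : Eucl n ↦ Real.arccos ⟪x, y⟫ :=
    Real.continuous_arccos.measurable.comp (by fun_prop)
  exact (measurableSet_eq_fun measurable_norm measurable_const).inter
    (measurableSet_lt h measurable_const)

theorem measurableSet_cBoxBall {n : ℕ} (x : Eucl n) (r : ℝ) : MeasurableSet (cBoxBall x r) := by
  have h : Measurable fun z : Eucl n ↦ ‖z‖⁻¹ • z := by fun_prop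
  exact (measurableSet_lt measurable_norm measurable_const).inter
    ((measurableSet_lt measurable_const measurable_norm).inter (h (measurableSet_sBall x r)))

theorem setLIntegral_cBoxBall {n : ℕ} (hn : 0 < n) (γ : ℝ) (x : Eucl n) {r : ℝ} (hr : r < 1) :
    ∫⁻ z in cBoxBall x r, ENNReal.ofReal ((1 - ‖z‖ ^ 2) ^ γ) =
      (∫⁻ u : sphere (0 : Eucl n) 1, (sBall x r).indicator 1 (u : Eucl n)
        ∂(volume : Measure (Eucl n)).toSphere) * radialIntegral n γ r := by
  have : Nonempty (Fin n) := ⟨⟨0, hn⟩⟩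
  have hf : Measurable ((Ioo (1 - r) 1).indicator fun t : ℝ ↦
      ENNReal.ofReal ((1 - t ^ 2) ^ γ)) :=
    Measurable.indicator (by fun_prop) measurableSet_Ioo
  have hg : Measurable ((sBall x r).indicator (1 : Eucl n → ℝ≥0∞)) :=
    measurable_one.indicator (measurableSet_sBall x r)
  rw [← lintegral_indicator (measurableSet_cBoxBall x r)]
  have hpolar := lintegral_angular_mul_radial volume hg hf
  rw [finrank_euclideanSpace_fin] at hpolar
  have hrad : radialIntegral n γ r = ∫⁻ t in Ioi (0 : ℝ), ENNReal.ofReal (t ^ (n - 1)) *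
      (Ioo (1 - r) 1).indicator (fun t : ℝ ↦ ENNReal.ofReal ((1 - t ^ 2) ^ γ)) t := by
    have hsub : Ioo (1 - r) 1 ⊆ Ioi (0 : ℝ) := fun t ht ↦ (sub_pos.2 hr).trans ht.1
    rw [radialIntegral, ← inter_eq_self_of_subset_left hsub,
      ← setLIntegral_indicator measurableSet_Ioo]
    refine setLIntegral_congr_fun measurableSet_Ioi fun t ht ↦ ?_
    have ht' : (0 : ℝ) ≤ t ^ (n - 1) := pow_nonneg (le_of_lt ht) _
    by_cases h : t ∈ Ioo (1 - r) 1
    · simp only [indicator_of_mem h, inter_eq_self_of_subset_left hsub, ENNReal.ofReal_mul ht']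
    · simp only [indicator_of_notMem h, inter_eq_self_of_subset_left hsub, mul_zero]
  rw [hrad, ← hpolar]
  refine lintegral_congr fun z ↦ ?_
  by_cases hz : z ∈ cBoxBall x r
  · have h2 : ‖z‖ ∈ Ioo (1 - r) 1 := ⟨hz.2.1, hz.1⟩
    rw [indicator_of_mem hz, indicator_of_mem hz.2.2, indicator_of_mem h2, Pi.one_apply, one_mul]
  · rw [indicator_of_notMem hz]
    by_cases h1 : ‖z‖⁻¹ • z ∈ sBall x r
    · have h2 : ‖z‖ ∉ Ioo (1 - r) 1 := fun h ↦ hz ⟨h.2, h.1, h1⟩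
      rw [indicator_of_notMem h2, mul_zero]
    · rw [indicator_of_notMem h1, zero_mul]

theorem wInt_cBoxBall {n : ℕ} (hn : 0 < n) (α γ : ℝ) (x : Eucl n) {r : ℝ} (hr : r < 1) :
    wInt α (fun z ↦ (1 - ‖z‖ ^ 2) ^ γ) (cBoxBall x r) =
      (muA n α univ)⁻¹ * ((∫⁻ u : sphere (0 : Eucl n) 1, (sBall x r).indicator 1 (u : Eucl n)
        ∂(volume : Measure (Eucl n)).toSphere) * radialIntegral n (α + γ) r) := by
  have hS := measurableSet_cBoxBall x r
  have hsub : cBoxBall x r ⊆ ball 0 1 := fun z hz ↦ by simpa using hz.1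
  rw [wInt, nuA, Measure.restrict_smul, lintegral_smul_measure, smul_eq_mul, muA,
    setLIntegral_withDensity_eq_setLIntegral_mul _ (by fun_prop) (by fun_prop) hS,
    Measure.restrict_restrict hS, inter_eq_self_of_subset_left hsub,
    ← setLIntegral_cBoxBall hn _ x hr]
  congr 1
  refine setLIntegral_congr_fun hS fun z hz ↦ ?_
  have hz1 : ‖z‖ < 1 := hz.1
  have hpos : 0 < 1 - ‖z‖ ^ 2 := by nlinarith [norm_nonneg z]
  simp only [Pi.mul_apply]
  rw [← ENNReal.ofReal_mul (by positivity), Real.rpow_add hpos]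

theorem nuA_cBoxBall {n : ℕ} (hn : 0 < n) (α : ℝ) (x : Eucl n) {r : ℝ} (hr : r < 1) :
    nuA n α (cBoxBall x r) =
      (muA n α univ)⁻¹ * ((∫⁻ u : sphere (0 : Eucl n) 1, (sBall x r).indicator 1 (u : Eucl n)
        ∂(volume : Measure (Eucl n)).toSphere) * radialIntegral n α r) := by
  have h := wInt_cBoxBall hn α 0 x hr
  simpa [wInt] using h

theorem lintegral_one_sub_rpow {β r : ℝ} (hβ : -1 < β) (hr : 0 < r) :
    ∫⁻ t in Ioo (1 - r) 1, ENNReal.ofReal ((1 - t) ^ β) =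
      ENNReal.ofReal (r ^ (β + 1) / (β + 1)) := by
  have hle : 1 - r ≤ 1 := by linarith
  have hint : IntervalIntegrable (fun t : ℝ ↦ (1 - t) ^ β) volume (1 - r) 1 := by
    have := (intervalIntegral.intervalIntegrable_rpow' (a := 0) (b := r) hβ).comp_sub_left 1
    simpa using this.symm
  rw [Measure.restrict_congr_set Ioo_ae_eq_Ioc, ← ofReal_integral_eq_lintegral_ofReal hint.1,
    ← intervalIntegral.integral_of_le hle,
    intervalIntegral.integral_comp_sub_left (fun t ↦ t ^ β) 1, integral_rpow (Or.inl hβ)]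
  · simp [Real.zero_rpow (by linarith : β + 1 ≠ 0)]
  · filter_upwards [ae_restrict_mem measurableSet_Ioc] with t ht
    exact Real.rpow_nonneg (by linarith [ht.2]) _

theorem radialIntegral_add_le (n : ℕ) (α : ℝ) {s r : ℝ} (hs : 0 ≤ s) (hr : 0 < r) (hr1 : r < 1) :
    radialIntegral n (α + s) r ≤ ENNReal.ofReal ((2 * r) ^ s) * radialIntegral n α r := by
  rw [radialIntegral, radialIntegral, ← lintegral_const_mul' _ _ ENNReal.ofReal_ne_top]
  refine setLIntegral_mono' measurableSet_Ioo fun t ht ↦ ?_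
  have ht0 : 0 < t := by linarith [ht.1]
  have hpos : 0 < 1 - t ^ 2 := by nlinarith [ht.2]
  rw [← ENNReal.ofReal_mul (by positivity)]
  apply ENNReal.ofReal_le_ofReal
  have h : (1 - t ^ 2) ^ s ≤ (2 * r) ^ s :=
    Real.rpow_le_rpow hpos.le (by nlinarith [ht.1, ht.2]) hs
  calc t ^ (n - 1) * (1 - t ^ 2) ^ (α + s)
      = (1 - t ^ 2) ^ s * (t ^ (n - 1) * (1 - t ^ 2) ^ α) := by rw [Real.rpow_add hpos]; ring
    _ ≤ _ := by gcongr

theorem one_sub_sq_rpow {t : ℝ} (h0 : 0 < t) (h1 : t < 1) (γ : ℝ) :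
    (1 - t ^ 2) ^ γ = (1 - t) ^ γ * (1 + t) ^ γ := by
  rw [← Real.mul_rpow (by linarith) (by linarith)]
  ring_nf

theorem radialIntegral_le (n : ℕ) {α β r : ℝ} (hα : -1 < α) (hβ : -1 < β) (hβα : β ≤ α + 1)
    (hr : 0 < r) (hr1 : r < 1) :
    radialIntegral n β r ≤ ENNReal.ofReal (2 ^ (α + 1) * (r ^ (β + 1) / (β + 1))) := by
  rw [ENNReal.ofReal_mul (by positivity), ← lintegral_one_sub_rpow hβ hr, radialIntegral,
    ← lintegral_const_mul' _ _ ENNReal.ofReal_ne_top]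
  refine setLIntegral_mono' measurableSet_Ioo fun t ht ↦ ?_
  have ht0 : 0 < t := by linarith [ht.1]
  have ht1 : 0 < 1 - t := by linarith [ht.2]
  rw [← ENNReal.ofReal_mul (by positivity)]
  apply ENNReal.ofReal_le_ofReal
  rw [one_sub_sq_rpow ht0 ht.2]
  have h1 : t ^ (n - 1) ≤ 1 := pow_le_one₀ ht0.le ht.2.le
  have h2 : (1 + t) ^ β ≤ 2 ^ (α + 1) :=
    (Real.rpow_le_rpow_of_exponent_le (by linarith) hβα).trans
      (Real.rpow_le_rpow (by linarith) (by linarith [ht.2]) (by linarith))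
  calc t ^ (n - 1) * ((1 - t) ^ β * (1 + t) ^ β) ≤ 1 * ((1 - t) ^ β * 2 ^ (α + 1)) := by gcongr
    _ = _ := by ring

theorem le_radialIntegral (n : ℕ) {α r : ℝ} (hα : -1 < α) (hr : 0 < r) (hr1 : r < 1) :
    ENNReal.ofReal ((1 / 2) ^ (n - 1) * (1 / 2) * ((r / 2) ^ (α + 1) / (α + 1))) ≤
      radialIntegral n α r := by
  rw [ENNReal.ofReal_mul (by positivity), ← lintegral_one_sub_rpow hα (half_pos hr),
    ← lintegral_const_mul' _ _ ENNReal.ofReal_ne_top, radialIntegral]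
  refine (setLIntegral_mono' measurableSet_Ioo fun t ht ↦ ?_).trans
    (lintegral_mono_set (Ioo_subset_Ioo_left (by linarith : 1 - r ≤ 1 - r / 2)))
  have ht0 : 1 / 2 ≤ t := by linarith [ht.1]
  have ht1 : 0 < 1 - t := by linarith [ht.2]
  rw [← ENNReal.ofReal_mul (by positivity)]
  apply ENNReal.ofReal_le_ofReal
  rw [one_sub_sq_rpow (by linarith) ht.2]
  have h2 : 1 / 2 ≤ (1 + t) ^ α := by
    refine le_trans ?_ (Real.rpow_le_rpow_of_exponent_le (by linarith) hα.le)
    rw [Real.rpow_neg_one, ← one_div]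
    exact one_div_le_one_div_of_le (by linarith) (by linarith [ht.2])
  calc (1 / 2 : ℝ) ^ (n - 1) * (1 / 2) * (1 - t) ^ α
      = (1 / 2) ^ (n - 1) * ((1 - t) ^ α * (1 / 2)) := by ring
    _ ≤ _ := by gcongr

theorem exists_radialIntegral_mul_le (n : ℕ) {α : ℝ} (hα : -1 < α) :
    ∃ c : ℝ, 0 < c ∧ ∀ δ r : ℝ, 0 < δ → δ < 1 → 0 < r → r < 1 →
      radialIntegral n (α + (α + 1) * (1 - δ)) r *
          radialIntegral n (α + -((α + 1) * (1 - δ))) r ≤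
        ENNReal.ofReal (c / δ) * radialIntegral n α r ^ 2 := by
  have ha : 0 < α + 1 := by linarith
  set k : ℝ := (1 / 2) ^ (n - 1) * (1 / 2) * ((1 / 2) ^ (α + 1) / (α + 1)) with hk
  have hk0 : 0 < k := by positivity
  refine ⟨2 ^ (α + 1) * 2 ^ (α + 1) / ((α + 1) * k), by positivity, fun δ r hδ hδ1 hr hr1 ↦ ?_⟩
  set s := (α + 1) * (1 - δ) with hs
  have hs0 : 0 ≤ s := mul_nonneg ha.le (by linarith)
  have hsle : s ≤ α + 1 := by nlinarith
  have hexp : α + -s + 1 = (α + 1) * δ := by rw [hs]; ring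
  have hβ : -1 < α + -s := by nlinarith [mul_pos ha hδ]
  have h1 := radialIntegral_add_le n α hs0 hr hr1
  have h2 := radialIntegral_le n hα hβ (by linarith) hr hr1
  have h3 := le_radialIntegral n hα hr hr1
  rw [hexp] at h2
  have hcore : (2 * r) ^ s * (2 ^ (α + 1) * (r ^ ((α + 1) * δ) / ((α + 1) * δ))) ≤
      2 ^ (α + 1) * 2 ^ (α + 1) / ((α + 1) * k) / δ *
        ((1 / 2) ^ (n - 1) * (1 / 2) * ((r / 2) ^ (α + 1) / (α + 1))) := by
    have hR : (1 / 2) ^ (n - 1) * (1 / 2) * ((r / 2) ^ (α + 1) / (α + 1)) = k * r ^ (α + 1) := by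
      rw [hk, div_eq_mul_one_div r 2, Real.mul_rpow hr.le (by norm_num)]
      ring
    have hrr : r ^ s * r ^ ((α + 1) * δ) = r ^ (α + 1) := by
      rw [← Real.rpow_add hr, hs]
      ring_nf
    have h2s : (2 : ℝ) ^ s ≤ 2 ^ (α + 1) := Real.rpow_le_rpow_of_exponent_le (by norm_num) hsle
    rw [hR, Real.mul_rpow (by norm_num) hr.le]
    calc (2 : ℝ) ^ s * r ^ s * (2 ^ (α + 1) * (r ^ ((α + 1) * δ) / ((α + 1) * δ)))
        = 2 ^ s * (2 ^ (α + 1) * (r ^ s * r ^ ((α + 1) * δ)) / ((α + 1) * δ)) := by ring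
      _ ≤ 2 ^ (α + 1) * (2 ^ (α + 1) * (r ^ s * r ^ ((α + 1) * δ)) / ((α + 1) * δ)) := by gcongr
      _ = _ := by rw [hrr]; field_simp
  calc _ ≤ ENNReal.ofReal ((2 * r) ^ s) * radialIntegral n α r *
        ENNReal.ofReal (2 ^ (α + 1) * (r ^ ((α + 1) * δ) / ((α + 1) * δ))) := mul_le_mul' h1 h2
    _ = ENNReal.ofReal ((2 * r) ^ s * (2 ^ (α + 1) * (r ^ ((α + 1) * δ) / ((α + 1) * δ)))) *
        radialIntegral n α r := by rw [ENNReal.ofReal_mul (p := (2 * r) ^ s) (by positivity)]; ring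
    _ ≤ ENNReal.ofReal (2 ^ (α + 1) * 2 ^ (α + 1) / ((α + 1) * k) / δ) *
        radialIntegral n α r * radialIntegral n α r := by
      gcongr
      refine (ENNReal.ofReal_le_ofReal hcore).trans ?_
      rw [ENNReal.ofReal_mul (by positivity)]
      gcongr
    _ = _ := by ring

/-- for `ω(x) = (1−|x|²)^s`, `s = (α+1)(1−δ)`, one has
`(∫_{B̂_ρ} ω dν_α)·(∫_{B̂_ρ} ω^{−1} dν_α) ≤ (c₃/δ)·ν_α(B̂_ρ)²` for every ball, and hence
`[ω]_{2,α} ≤ c₃/δ`, with `c₃` depending only on `n` and `α` (not on `δ`). -/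
theorem stmt4 (n : ℕ) (hn : 3 ≤ n) (α : ℝ) (hα : -1 < α) :
    ∃ c₃ : ℝ, 0 < c₃ ∧
      ∀ δ : ℝ, 0 < δ → δ < 1 →
        (∀ (x : Eucl n) (r : ℝ), ‖x‖ = 1 → 0 < r → r < 1 →
          wInt α (fun z => (1 - ‖z‖ ^ 2) ^ ((α + 1) * (1 - δ))) (cBoxBall x r) *
              wInt α (fun z => (1 - ‖z‖ ^ 2) ^ (-((α + 1) * (1 - δ)))) (cBoxBall x r) ≤
            ENNReal.ofReal (c₃ / δ) * nuA n α (cBoxBall x r) ^ 2) ∧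
        BB n 2 α (fun z => (1 - ‖z‖ ^ 2) ^ ((α + 1) * (1 - δ))) ≤
          ENNReal.ofReal (c₃ / δ) := by
  obtain ⟨c, hc, H⟩ := exists_radialIntegral_mul_le n hα
  have hn0 : 0 < n := by omega
  refine ⟨c, hc, fun δ hδ hδ1 ↦ ?_⟩
  have hbox : ∀ (x : Eucl n) (r : ℝ), ‖x‖ = 1 → 0 < r → r < 1 →
      wInt α (fun z => (1 - ‖z‖ ^ 2) ^ ((α + 1) * (1 - δ))) (cBoxBall x r) *
          wInt α (fun z => (1 - ‖z‖ ^ 2) ^ (-((α + 1) * (1 - δ)))) (cBoxBall x r) ≤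
        ENNReal.ofReal (c / δ) * nuA n α (cBoxBall x r) ^ 2 := by
    intro x r _ hr hr1
    rw [wInt_cBoxBall hn0 _ _ x hr1, wInt_cBoxBall hn0 _ _ x hr1, nuA_cBoxBall hn0 _ x hr1]
    set m := (muA n α univ)⁻¹
    set A := ∫⁻ u : sphere (0 : Eucl n) 1, (sBall x r).indicator 1 (u : Eucl n)
      ∂(volume : Measure (Eucl n)).toSphere
    calc _ = (m * A) ^ 2 * (radialIntegral n (α + (α + 1) * (1 - δ)) r *
          radialIntegral n (α + -((α + 1) * (1 - δ))) r) := by ring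
      _ ≤ (m * A) ^ 2 * (ENNReal.ofReal (c / δ) * radialIntegral n α r ^ 2) := by
        exact mul_le_mul_right (H δ r hδ hδ1 hr hr1) _
      _ = _ := by ring
  refine ⟨hbox, ?_⟩
  refine iSup_le fun x ↦ iSup_le fun hx ↦ iSup_le fun r ↦ iSup_le fun hr ↦ iSup_le fun hr1 ↦ ?_
  have hinv : wInt α (fun z ↦ ((1 - ‖z‖ ^ 2) ^ ((α + 1) * (1 - δ))) ^ (1 - (2 : ℝ) / (2 - 1)))
        (cBoxBall x r) =
      wInt α (fun z => (1 - ‖z‖ ^ 2) ^ (-((α + 1) * (1 - δ)))) (cBoxBall x r) := by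
    refine setLIntegral_congr_fun (measurableSet_cBoxBall x r) fun z hz ↦ ?_
    have hz1 : ‖z‖ < 1 := hz.1
    have hpos : 0 ≤ 1 - ‖z‖ ^ 2 := by nlinarith [norm_nonneg z]
    simp only
    rw [← Real.rpow_mul hpos]
    norm_num
  rw [hinv, show (2 : ℝ) - 1 = 1 by norm_num, ENNReal.rpow_one]
  set v := nuA n α (cBoxBall x r)
  calc _ = wInt α (fun z => (1 - ‖z‖ ^ 2) ^ ((α + 1) * (1 - δ))) (cBoxBall x r) *
          wInt α (fun z => (1 - ‖z‖ ^ 2) ^ (-((α + 1) * (1 - δ)))) (cBoxBall x r) *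
          v⁻¹ ^ 2 := by
        rw [div_eq_mul_inv, div_eq_mul_inv]
        ring
    _ ≤ ENNReal.ofReal (c / δ) * v ^ 2 * v⁻¹ ^ 2 := by
        exact mul_le_mul_left (hbox x r hx hr hr1) _
    _ = ENNReal.ofReal (c / δ) * (v * v⁻¹) ^ 2 := by ring
    _ ≤ ENNReal.ofReal (c / δ) * 1 ^ 2 := by
        gcongr
        exact ENNReal.mul_inv_le_one v
    _ = _ := by simp
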